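/- Let α > 0 and λ > 0, and let Z be a random variable on [0, ∞) whose density is the normalized RMM kernel f(z) = κ·exp(−(α/λ)·(z^λ − 1)) with κ = λ·e^{−α/λ}·(α/λ)^{1/λ}/Γ(1/λ). Then the mean of Z is E(Z) = (α/λ)^{−1/λ}·Γ(2/λ)/Γ(1/λ). -/

import Mathlib

open Real MeasureTheory

/-- For `α, λ > 0`, if `Z` is a random variable on `[0, ∞)` whose density is the
normalized RMM kernel `f(z) = κ·exp(−(α/λ)·(z^λ − 1))` with
`κ = λ·e^{−α/λ}·(α/λ)^{1/λ}/Γ(1/λ)`, then `E(Z) = (α/λ)^{−1/λ}·Γ(2/λ)/Γ(1/λ)`. -/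
theorem rmm_mean (α lam κ : ℝ) (hα : 0 < α) (hlam : 0 < lam)
    (hκ : κ = lam * Real.exp (-α / lam) * (α / lam) ^ ((1 : ℝ) / lam) /
      Real.Gamma (1 / lam))
    {Ω : Type*} [MeasurableSpace Ω] (P : Measure Ω) [IsProbabilityMeasure P]
    (Z : Ω → ℝ) (hZ : Measurable Z)
    (hlaw : Measure.map Z P = volume.withDensity
      (fun z => ENNReal.ofReal
        (if 0 ≤ z then κ * Real.exp (-(α / lam) * (z ^ lam - 1)) else 0))) :
    ∫ ω, Z ω ∂P =
      (α / lam) ^ (-((1 : ℝ) / lam)) * Real.Gamma (2 / lam) / Real.Gamma (1 / lam) := by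
  have hb : 0 < α / lam := div_pos hα hlam
  have hΓ : 0 < Real.Gamma (1 / lam) := Real.Gamma_pos_of_pos (by positivity)
  have hκ0 : 0 ≤ κ := by rw [hκ]; positivity
  have hdens : Measurable fun z : ℝ =>
      if 0 ≤ z then κ * Real.exp (-(α / lam) * (z ^ lam - 1)) else 0 :=
    Measurable.ite measurableSet_Ici (by fun_prop) measurable_const
  have hdens0 (z : ℝ) :
      0 ≤ if 0 ≤ z then κ * Real.exp (-(α / lam) * (z ^ lam - 1)) else 0 := by
    split_ifs <;> positivity
  calc ∫ ω, Z ω ∂P = ∫ z, z ∂(Measure.map Z P) :=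
        (integral_map hZ.aemeasurable aestronglyMeasurable_id).symm
    _ = ∫ z, (if 0 ≤ z then κ * Real.exp (-(α / lam) * (z ^ lam - 1)) else 0) * z := by
        rw [hlaw, integral_withDensity_eq_integral_toReal_smul hdens.ennreal_ofReal
          (by simp)]
        simp only [ENNReal.toReal_ofReal (hdens0 _), smul_eq_mul]
    _ = ∫ z in Set.Ici (0 : ℝ), κ * Real.exp (-(α / lam) * (z ^ lam - 1)) * z := by
        rw [← integral_indicator measurableSet_Ici]
        simp only [Set.indicator_apply, Set.mem_Ici, ite_mul, zero_mul]
    _ = ∫ z in Set.Ioi (0 : ℝ), κ * Real.exp (α / lam) *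
          (z ^ (1 : ℝ) * Real.exp (-(α / lam) * z ^ lam)) := by
        rw [integral_Ici_eq_integral_Ioi]
        refine integral_congr_ae (.of_forall fun z => ?_)
        have hexp : Real.exp (-(α / lam) * (z ^ lam - 1)) =
            Real.exp (α / lam) * Real.exp (-(α / lam) * z ^ lam) := by
          rw [← Real.exp_add]; ring_nf
        simp only [hexp, Real.rpow_one]
        ring
    _ = (α / lam) ^ (-((1 : ℝ) / lam)) * Real.Gamma (2 / lam) / Real.Gamma (1 / lam) := by
        rw [integral_const_mul, integral_rpow_mul_exp_neg_mul_rpow hlam (by norm_num) hb, hκ,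
          neg_div, Real.exp_neg, one_add_one_eq_two]
        have hpow : (α / lam) ^ (-((1 : ℝ) / lam)) =
            (α / lam) ^ ((1 : ℝ) / lam) * (α / lam) ^ (-2 / lam) := by
          rw [← Real.rpow_add hb]; ring_nf
        rw [hpow]
        have hexp := Real.exp_ne_zero (α / lam)
        generalize Real.exp (α / lam) = e at *
        generalize (α / lam) ^ ((1 : ℝ) / lam) = u
        generalize (α / lam) ^ (-2 / lam) = v
        field_simp
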